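/- arXiv:1411.5123 — 2 statements merged into one kernel-verified Lean document; each statement's English description precedes it below -/
import Mathlib

section
/- There exist absolute constants C > 0 and c ≥ 1 with the following property. For every finite simple connected graph G on vertex set V with n vertices, m edges, and minimum degree δ ≥ 1, there exists a partition P of V into nonempty pairwise disjoint parts such that: (i) for every non-trivial minimum cut S of G, S is a union of parts of P; (ii) the number of edges of G whose endpoints lie in two distinct parts of P is at most C·m·(log(n+2))^c/δ; and (iii) the number of parts of P is at most C·n·(log(n+2))^c/δ. -/
open scoped Classical
open Finset

noncomputable section

variable {V : Type*} [Fintype V]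

/-- The set of edges of `G` with exactly one endpoint in `S`. -/
def bdry (G : SimpleGraph V) (S : Finset V) : Finset (Sym2 V) :=
  G.edgeFinset.filter fun e => ∃ u v, u ∈ S ∧ v ∉ S ∧ e = s(u, v)

/-- The edge connectivity of `G`: the minimum of `|∂S|` over nonempty proper `S ⊆ V`. -/
def econn (G : SimpleGraph V) : ℕ :=
  sInf {k | ∃ S : Finset V, S.Nonempty ∧ S ≠ Finset.univ ∧ (bdry G S).card = k}

/-- `S` is a non-trivial minimum cut: nonempty, proper, realizing the edge connectivity,
with at least two vertices on each side. -/
def IsNontrivialMinCut (G : SimpleGraph V) (S : Finset V) : Prop :=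
  S.Nonempty ∧ S ≠ Finset.univ ∧ (bdry G S).card = econn G ∧ 2 ≤ S.card ∧ 2 ≤ Sᶜ.card

/-- `P` is a partition of the vertex set into nonempty, pairwise disjoint parts. -/
def IsPartition (P : Finset (Finset V)) : Prop :=
  (∀ p ∈ P, p.Nonempty) ∧
  (∀ p ∈ P, ∀ q ∈ P, p ≠ q → Disjoint p q) ∧
  P.sup id = Finset.univ

/-- The edges of `G` whose endpoints lie in two distinct parts of `P`. -/
def crossEdges (G : SimpleGraph V) (P : Finset (Finset V)) : Finset (Sym2 V) :=
  G.edgeFinset.filter fun e => ¬ ∃ p ∈ P, ∀ x ∈ e, x ∈ p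

/-! ### Laminar families -/

/-- Two sets that are nested or disjoint. -/
def NestedOrDisjoint (A B : Finset V) : Prop := A ⊆ B ∨ B ⊆ A ∨ Disjoint A B

/-- A family of sets that are pairwise nested or disjoint. -/
def IsLaminar (L : Finset (Finset V)) : Prop := ∀ A ∈ L, ∀ B ∈ L, NestedOrDisjoint A B

theorem NestedOrDisjoint.symm {α : Type*} {A B : Finset α} (h : NestedOrDisjoint A B) :
    NestedOrDisjoint B A := by
  rcases h with h | h | h
  · exact Or.inr (Or.inl h)
  · exact Or.inl h
  · exact Or.inr (Or.inr h.symm)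

theorem not_nestedOrDisjoint_iff {α : Type*} {A B : Finset α} :
    ¬ NestedOrDisjoint A B ↔
      (∃ x ∈ A, x ∉ B) ∧ (∃ x ∈ B, x ∉ A) ∧ ∃ x ∈ A, x ∈ B := by
  simp only [NestedOrDisjoint, not_or, Finset.not_subset, Finset.not_disjoint_iff]

theorem IsLaminar.mono {α : Type*} {L L' : Finset (Finset α)} (h : IsLaminar L) (hL : L' ⊆ L) :
    IsLaminar L' := fun A hA B hB => h A (hL hA) B (hL hB)

/-- A laminar family has a largest member, or splits into two families with disjoint supports. -/
theorem IsLaminar.exists_top_or_split {L : Finset (Finset V)} (hL : IsLaminar L)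
    (hne : L.Nonempty) :
    (∃ M ∈ L, ∀ T ∈ L, T ⊆ M) ∨
      ∃ L₁ ⊆ L, ∃ L₂ ⊆ L, L₁.Nonempty ∧ L₂.Nonempty ∧ L₁.card + L₂.card = L.card ∧
        (L₁.biUnion id).card + (L₂.biUnion id).card = (L.biUnion id).card := by
  obtain ⟨M, hM⟩ := L.exists_maximal hne
  by_cases h : ∀ T ∈ L, T ⊆ M
  · exact Or.inl ⟨M, hM.prop, h⟩
  right
  push Not at h
  obtain ⟨T, hT, hTM⟩ := h
  refine ⟨L.filter (· ⊆ M), filter_subset _ _, L.filter (¬ · ⊆ M), filter_subset _ _,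
    ⟨M, by simp [hM.prop]⟩, ⟨T, by simp [hT, hTM]⟩, card_filter_add_card_filter_not _, ?_⟩
  rw [← card_union_of_disjoint, ← union_biUnion, filter_union_filter_not_eq]
  rw [disjoint_biUnion_left]
  intro A hA
  rw [disjoint_biUnion_right]
  intro B hB
  rw [mem_filter] at hA hB
  have : Disjoint M B := by
    rcases hL M hM.prop B hB.1 with h | h | h
    · exact absurd (hM.le_of_ge hB.1 h) hB.2
    · exact absurd h hB.2
    · exact h
  exact this.mono_left hA.2

/-- A laminar family of sets of size at least `δ` in which every chain of four members gains
at least `δ / 2` elements has at most `6 / δ` members per element of its support. -/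
theorem IsLaminar.card_bound {δ : ℕ} (hδ : 1 ≤ δ) (L : Finset (Finset V)) (hL : IsLaminar L)
    (hne : L.Nonempty) (hsize : ∀ A ∈ L, δ ≤ A.card)
    (hchain : ∀ A ∈ L, ∀ B ∈ L, ∀ C ∈ L, ∀ D ∈ L, A ⊂ B → B ⊂ C → C ⊂ D →
      δ + 2 * A.card ≤ 2 * D.card) :
    δ * (L.card + 3) ≤ 6 * (L.biUnion id).card := by
  induction hk : L.card using Nat.strong_induction_on generalizing L with
  | _ k ih =>
  subst hk
  have ih' : ∀ K ⊆ L, K.Nonempty → K.card < L.card →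
      δ * (K.card + 3) ≤ 6 * (K.biUnion id).card := fun K hK hKne hlt =>
    ih K.card hlt K (hL.mono hK) hKne (fun A hA => hsize A (hK hA))
      (fun A hA B hB C hC D hD => hchain A (hK hA) B (hK hB) C (hK hC) D (hK hD)) rfl
  have key : ∀ K ⊆ L, K.Nonempty →
      (∃ M ∈ K, (∀ T ∈ K, T ⊆ M) ∧ K.biUnion id = M ∧ (K.erase M).card + 1 = K.card ∧
        (K.erase M).biUnion id ⊆ M ∧ ∀ T ∈ K.erase M, T ⊂ M) ∨
      δ * (K.card + 6) ≤ 6 * (K.biUnion id).card := by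
    intro K hK hKne
    rcases (hL.mono hK).exists_top_or_split hKne with ⟨M, hM, hT⟩ | h
    · refine Or.inl ⟨M, hM, hT, ?_, card_erase_add_one hM, ?_, ?_⟩
      · exact Subset.antisymm (biUnion_subset.2 hT) (subset_biUnion_of_mem id hM)
      · exact biUnion_subset.2 fun T hTK => hT T (mem_of_mem_erase hTK)
      · intro T hTK
        exact (hT T (mem_of_mem_erase hTK)).ssubset_of_ne (ne_of_mem_erase hTK)
    · right
      obtain ⟨L₁, h₁, L₂, h₂, hn₁, hn₂, hc, hs⟩ := h
      have c₁ := hn₁.card_pos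
      have c₂ := hn₂.card_pos
      have hKL := card_le_card hK
      have e₁ := ih' L₁ (h₁.trans hK) hn₁ (by omega)
      have e₂ := ih' L₂ (h₂.trans hK) hn₂ (by omega)
      rw [← hc, ← hs]
      nlinarith
  rcases key L (Subset.refl _) hne with ⟨M₁, hM₁, -, hU₁, hc₁, hs₁, hlt₁⟩ | h
  swap
  · nlinarith
  have hM₁δ := hsize _ hM₁
  rw [hU₁, ← hc₁]
  rcases (L.erase M₁).eq_empty_or_nonempty with he | hne₁
  · rw [he, card_empty]; omega
  have hsub₁ := erase_subset M₁ L
  rcases key _ hsub₁ hne₁ with ⟨M₂, hM₂, -, hU₂, hc₂, hs₂, hlt₂⟩ | h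
  swap
  · have := card_le_card hs₁
    nlinarith
  have hsub₂ := (erase_subset M₂ _).trans hsub₁
  rw [← hc₂]
  rcases ((L.erase M₁).erase M₂).eq_empty_or_nonempty with he | hne₂
  · rw [he, card_empty]; omega
  have hl₁ := card_le_card (hlt₁ M₂ hM₂).subset
  rcases key _ hsub₂ hne₂ with ⟨M₃, hM₃, -, hU₃, hc₃, hs₃, hlt₃⟩ | h
  swap
  · have := card_le_card hs₂
    nlinarith
  have hsub₃ := (erase_subset M₃ _).trans hsub₂
  rw [← hc₃]
  rcases (((L.erase M₁).erase M₂).erase M₃).eq_empty_or_nonempty with he | hne₃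
  · rw [he, card_empty]; omega
  have hl₂ := card_le_card (hlt₂ M₃ hM₃).subset
  rcases key _ hsub₃ hne₃ with ⟨M₄, hM₄, -, hU₄, hc₄, hs₄, hlt₄⟩ | h
  swap
  · have := card_le_card hs₃
    nlinarith
  have e := ih' _ hsub₃ hne₃ (by omega)
  have g := hchain M₄ (hsub₃ hM₄) M₃ (hsub₂ hM₃) M₂ (hsub₁ hM₂) M₁ hM₁ (hlt₃ _ hM₄)
    (hlt₂ _ hM₃) (hlt₁ _ hM₂)
  rw [hU₄] at e
  nlinarith

/-- The partition of `V` into the classes of vertices not separated by any member of `L`. -/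
def atoms (L : Finset (Finset V)) : Finset (Finset V) :=
  univ.image fun u => univ.filter fun v => ∀ S ∈ L, u ∈ S ↔ v ∈ S

theorem isPartition_atoms (L : Finset (Finset V)) : IsPartition (atoms L) := by
  refine ⟨?_, ?_, ?_⟩
  · intro p hp
    obtain ⟨u, -, rfl⟩ := mem_image.1 hp
    exact ⟨u, by simp⟩
  · intro p hp q hq hne
    obtain ⟨u, -, rfl⟩ := mem_image.1 hp
    obtain ⟨v, -, rfl⟩ := mem_image.1 hq
    rw [disjoint_left]
    intro x hx hy
    apply hne
    ext y
    simp only [mem_filter, mem_univ, true_and] at hx hy ⊢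
    exact forall₂_congr fun S hS => by rw [hx S hS, ← hy S hS]
  · ext x
    simp only [mem_univ, iff_true, mem_sup]
    exact ⟨_, mem_image_of_mem _ (mem_univ x), by simp⟩

theorem IsLaminar.card_atoms_le {L : Finset (Finset V)} (hL : IsLaminar L) :
    (atoms L).card ≤ L.card + 1 := by
  have hex : ∀ u : V, ∃ M ∈ insert univ L, u ∈ M ∧ ∀ S ∈ L, u ∈ S → M ⊆ S := by
    intro u
    obtain ⟨M, hM⟩ := ((insert univ L).filter (u ∈ ·)).exists_minimal ⟨univ, by simp⟩
    have hM' := mem_filter.1 hM.prop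
    refine ⟨M, hM'.1, hM'.2, fun S hS hu => ?_⟩
    have hSm : S ∈ (insert univ L).filter (u ∈ ·) := mem_filter.2 ⟨mem_insert_of_mem hS, hu⟩
    rcases mem_insert.1 hM'.1 with rfl | hML
    · exact hM.le_of_le hSm (subset_univ _)
    rcases hL M hML S hS with h | h | h
    · exact h
    · exact hM.le_of_le hSm h
    · exact absurd hu (disjoint_left.1 h hM'.2)
  choose f hf hfm hfs using hex
  refine (card_le_card_of_surjOn
    (fun A => univ.filter fun v => ∀ S ∈ L, A ⊆ S ↔ v ∈ S) ?_).trans (card_insert_le univ L)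
  intro p hp
  obtain ⟨u, -, rfl⟩ := mem_image.1 (mem_coe.1 hp)
  refine ⟨f u, mem_coe.2 (hf u), ?_⟩
  ext v
  simp only [mem_filter, mem_univ, true_and]
  exact forall₂_congr fun S hS => by
    rw [show f u ⊆ S ↔ u ∈ S from ⟨fun h => h (hfm u), hfs u S hS⟩]

/-! ### Edge boundaries -/

theorem mem_bdry {G : SimpleGraph V} {S : Finset V} {u v : V} :
    s(u, v) ∈ bdry G S ↔ G.Adj u v ∧ ((u ∈ S ∧ v ∉ S) ∨ (v ∈ S ∧ u ∉ S)) := by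
  simp only [bdry, mem_filter, SimpleGraph.mem_edgeFinset, SimpleGraph.mem_edgeSet]
  refine and_congr_right fun _ => ⟨?_, ?_⟩
  · rintro ⟨a, b, ha, hb, h⟩
    rcases Sym2.eq_iff.1 h with ⟨rfl, rfl⟩ | ⟨rfl, rfl⟩
    · exact Or.inl ⟨ha, hb⟩
    · exact Or.inr ⟨ha, hb⟩
  · rintro (⟨h, h'⟩ | ⟨h, h'⟩)
    · exact ⟨u, v, h, h', rfl⟩
    · exact ⟨v, u, h, h', Sym2.eq_swap⟩

theorem bdry_compl (G : SimpleGraph V) (S : Finset V) : bdry G Sᶜ = bdry G S := by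
  ext e
  induction e with | _ u v
  simp only [mem_bdry, mem_compl]
  tauto

theorem card_bdry_inter_add_card_bdry_union_le (G : SimpleGraph V) (S T : Finset V) :
    (bdry G (S ∩ T)).card + (bdry G (S ∪ T)).card ≤ (bdry G S).card + (bdry G T).card := by
  rw [← card_union_add_card_inter, ← card_union_add_card_inter (bdry G S)]
  apply Nat.add_le_add <;> apply card_le_card <;> intro e <;> induction e with | _ u v
  · simp only [mem_bdry, mem_union, mem_inter]
    tauto
  · simp only [mem_bdry, mem_union, mem_inter]
    tauto

theorem card_bdry_sdiff_add_card_bdry_sdiff_le (G : SimpleGraph V) (S T : Finset V) :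
    (bdry G (S \ T)).card + (bdry G (T \ S)).card ≤ (bdry G S).card + (bdry G T).card := by
  have h := card_bdry_inter_add_card_bdry_union_le G S Tᶜ
  rw [bdry_compl, ← bdry_compl G (S ∪ Tᶜ)] at h
  convert h using 4
  · ext; simp
  · ext; simp [and_comm]

theorem card_bdry_sdiff_le (G : SimpleGraph V) {S T : Finset V} :
    (bdry G (T \ S)).card ≤ (bdry G T).card + (bdry G S).card := by
  refine (card_le_card ?_).trans (card_union_le _ _)
  intro e
  induction e with | _ u v
  simp only [mem_bdry, mem_union, mem_sdiff]
  tauto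

/-- A vertex of `S` has at most `|S| - 1` neighbours in `S`, so `S` has many boundary edges. -/
theorem card_mul_minDegree_le (G : SimpleGraph V) (S : Finset V) :
    S.card * G.minDegree ≤ (bdry G S).card + S.card * (S.card - 1) := by
  have h1 : (S.sigma fun u => G.neighborFinset u \ S).card ≤ (bdry G S).card := by
    refine card_le_card_of_injOn (fun x => s(x.1, x.2)) ?_ ?_
    · rintro ⟨u, v⟩ h
      simp only [coe_sigma, Set.mem_sigma_iff, mem_coe, mem_sdiff,
        SimpleGraph.mem_neighborFinset] at h
      exact mem_coe.2 (mem_bdry.2 ⟨h.2.1, Or.inl ⟨h.1, h.2.2⟩⟩)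
    · rintro ⟨u, v⟩ h ⟨u', v'⟩ h' he
      simp only [coe_sigma, Set.mem_sigma_iff, mem_coe, mem_sdiff,
        SimpleGraph.mem_neighborFinset] at h h'
      rcases Sym2.eq_iff.1 he with ⟨rfl, rfl⟩ | ⟨rfl, rfl⟩
      · rfl
      · exact absurd h.1 h'.2.2
  rw [card_sigma] at h1
  have h2 : ∑ _u ∈ S, G.minDegree ≤
      ∑ u ∈ S, ((G.neighborFinset u \ S).card + (S.card - 1)) := by
    refine sum_le_sum fun u hu => ?_
    have hd := G.minDegree_le_degree u
    rw [← G.card_neighborFinset_eq_degree, ← card_sdiff_add_card_inter _ S] at hd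
    have : G.neighborFinset u ∩ S ⊆ S.erase u := by
      intro v hv
      simp only [mem_inter, SimpleGraph.mem_neighborFinset] at hv
      exact mem_erase.2 ⟨hv.1.ne', hv.2⟩
    have := card_le_card this
    rw [card_erase_of_mem hu] at this
    omega
  rw [sum_add_distrib, sum_const, sum_const, smul_eq_mul, smul_eq_mul] at h2
  omega

/-! ### Minimum cuts -/

theorem econn_le (G : SimpleGraph V) {S : Finset V} (h : S.Nonempty) (h' : S ≠ univ) :
    econn G ≤ (bdry G S).card := Nat.sInf_le ⟨S, h, h', rfl⟩

theorem econn_le_minDegree (G : SimpleGraph V) (h : 1 ≤ G.minDegree) :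
    econn G ≤ G.minDegree := by
  have hne : Nonempty V := by
    by_contra hV
    rw [not_nonempty_iff] at hV
    simp at h
  obtain ⟨v, hv⟩ := G.exists_minimal_degree_vertex
  have hcard := G.degree_lt_card_verts v
  refine (econn_le G (singleton_nonempty v) ?_).trans ?_
  · intro hu
    have := congrArg Finset.card hu
    rw [card_singleton, card_univ] at this
    omega
  · rw [hv, ← G.card_incidenceFinset_eq_degree]
    refine card_le_card fun e => ?_
    induction e with | _ a b
    simp only [mem_bdry, mem_singleton, SimpleGraph.mem_incidenceFinset,
      SimpleGraph.mk'_mem_incidenceSet_iff]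
    rintro ⟨h, ⟨rfl, -⟩ | ⟨rfl, -⟩⟩
    · exact ⟨h, Or.inl rfl⟩
    · exact ⟨h, Or.inr rfl⟩

theorem IsNontrivialMinCut.compl {G : SimpleGraph V} {S : Finset V}
    (h : IsNontrivialMinCut G S) : IsNontrivialMinCut G Sᶜ := by
  obtain ⟨h1, h2, h3, h4, h5⟩ := h
  refine ⟨card_pos.1 (by omega), ?_, ?_, h5, by rwa [compl_compl]⟩
  · rwa [Ne, compl_eq_univ_iff, ← Ne, ← nonempty_iff_ne_empty]
  · rwa [bdry_compl]

theorem IsNontrivialMinCut.minDegree_le_card {G : SimpleGraph V} {S : Finset V}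
    (h : IsNontrivialMinCut G S) (hδ : 1 ≤ G.minDegree) : G.minDegree ≤ S.card := by
  have h1 := card_mul_minDegree_le G S
  have h2 := econn_le_minDegree G hδ
  obtain ⟨-, -, h3, h4, -⟩ := h
  obtain ⟨s, hs⟩ : ∃ s, S.card = s + 2 := ⟨S.card - 2, by omega⟩
  rw [h3, hs] at h1
  rw [hs]
  have h1' : (s + 2) * G.minDegree ≤ econn G + (s + 2) * (s + 1) := h1
  by_contra! hlt
  nlinarith

theorem minDegree_add_card_le_of_chain {G : SimpleGraph V} (hδ : 1 ≤ G.minDegree)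
    {A B C D : Finset V} (hA : (bdry G A).card = econn G) (hD : (bdry G D).card = econn G)
    (hAB : A ⊂ B) (hBC : B ⊂ C) (hCD : C ⊂ D) :
    G.minDegree + 2 * A.card ≤ 2 * D.card := by
  have h1 := card_mul_minDegree_le G (D \ A)
  have h2 := econn_le_minDegree G hδ
  have h3 : (bdry G (D \ A)).card ≤ _ := card_bdry_sdiff_le G
  have hAD := hAB.subset.trans (hBC.subset.trans hCD.subset)
  have h4 := card_sdiff_add_card_eq_card hAD
  have h5 := card_lt_card hAB
  have h6 := card_lt_card hBC
  have h7 := card_lt_card hCD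
  obtain ⟨s, hs⟩ : ∃ s, (D \ A).card = s + 3 := ⟨(D \ A).card - 3, by omega⟩
  rw [hs] at h1 h4
  have h1' : (s + 3) * G.minDegree ≤ (bdry G (D \ A)).card + (s + 3) * (s + 2) := h1
  rw [hA, hD] at h3
  by_contra! hlt
  have h8 : 2 * s + 7 ≤ G.minDegree := by omega
  nlinarith

theorem isNontrivialMinCut_of_card_add_le {G : SimpleGraph V} {X Y : Finset V}
    (hX : X.Nonempty) (hX' : X ≠ univ) (hY : Y.Nonempty) (hY' : Y ≠ univ)
    (h : (bdry G X).card + (bdry G Y).card ≤ econn G + econn G)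
    (h2 : 2 ≤ X.card) (h2' : 2 ≤ Xᶜ.card) : IsNontrivialMinCut G X := by
  have h3 := econn_le G hX hX'
  have h4 := econn_le G hY hY'
  exact ⟨hX, hX', by omega, h2, h2'⟩

/-- Uncrossing: a cut `S` separating `u` and `v` and crossing a cut `T` not separating them can be
replaced by a corner of `S` and `T` that still separates `u` and `v`. -/
theorem exists_uncrossing {G : SimpleGraph V} (hδ : 3 ≤ G.minDegree) {r u v : V}
    {S T : Finset V} (hS : IsNontrivialMinCut G S) (hT : IsNontrivialMinCut G T)
    (hrS : r ∉ S) (hrT : r ∉ T) (hu : u ∈ S) (hv : v ∉ S) (huv : u ∈ T ↔ v ∈ T)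
    (hc : ¬ NestedOrDisjoint S T) :
    ∃ X, IsNontrivialMinCut G X ∧ r ∉ X ∧ ¬ (u ∈ X ↔ v ∈ X) ∧
      (X = S ∩ T ∨ X = T \ S ∨ X = S \ T ∨ X = S ∪ T) := by
  obtain ⟨⟨a, haS, haT⟩, ⟨b, hbT, hbS⟩, c, hcS, hcT⟩ := not_nestedOrDisjoint_iff.1 hc
  have hsub := card_bdry_inter_add_card_bdry_union_le G S T
  have hpos := card_bdry_sdiff_add_card_bdry_sdiff_le G S T
  rw [hS.2.2.1, hT.2.2.1] at hsub hpos
  have hTδ := hT.minDegree_le_card (by omega)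
  have hTcδ := hT.compl.minDegree_le_card (by omega)
  have huniv : ∀ {X : Finset V}, r ∉ X → X ≠ univ := fun h h' => h (h' ▸ mem_univ r)
  have nI : (S ∩ T).Nonempty := ⟨c, by simp [*]⟩
  have nU : (S ∪ T).Nonempty := ⟨c, by simp [*]⟩
  have nST : (S \ T).Nonempty := ⟨a, by simp [*]⟩
  have nTS : (T \ S).Nonempty := ⟨b, by simp [*]⟩
  have rI : r ∉ S ∩ T := by simp [*]
  have rU : r ∉ S ∪ T := by simp [*]
  have rST : r ∉ S \ T := by simp [*]
  have rTS : r ∉ T \ S := by simp [*]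
  have hcompl : ∀ {X Y : Finset V}, X ⊆ Y → Yᶜ.card ≤ Xᶜ.card := fun h =>
    card_le_card (compl_subset_compl.2 h)
  by_cases huT : u ∈ T
  · have hvT := huv.1 huT
    have hsum := card_sdiff_add_card_inter T S
    rw [inter_comm] at hsum
    by_cases h2 : 2 ≤ (S ∩ T).card
    · refine ⟨S ∩ T, isNontrivialMinCut_of_card_add_le nI (huniv rI) nU (huniv rU) hsub h2
        (hT.2.2.2.2.trans (hcompl inter_subset_right)), rI, by simp [*], by simp⟩
    · refine ⟨T \ S, isNontrivialMinCut_of_card_add_le nTS (huniv rTS) nST (huniv rST)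
        (by omega) (by omega)
        (hT.2.2.2.2.trans (hcompl sdiff_subset)), rTS, by simp [*], by simp⟩
  · have hvT : v ∉ T := fun h => huT (huv.2 h)
    have hsum : (S \ T).card + (S ∪ T)ᶜ.card = Tᶜ.card := by
      rw [← card_union_of_disjoint]
      · congr 1
        ext x
        simp only [mem_union, mem_sdiff, mem_compl]
        tauto
      · rw [disjoint_left]
        intro x
        simp only [mem_union, mem_sdiff, mem_compl]
        tauto
    by_cases h2 : 2 ≤ (S \ T).card
    · exact ⟨S \ T, isNontrivialMinCut_of_card_add_le nST (huniv rST) nTS (huniv rTS) hpos h2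
        (hS.2.2.2.2.trans (hcompl sdiff_subset)), rST, by simp [*], by simp⟩
    · exact ⟨S ∪ T, isNontrivialMinCut_of_card_add_le nU (huniv rU) nI (huniv rI) (by omega)
        (hS.2.2.2.1.trans (card_le_card subset_union_left)) (by omega), rU, by simp [*],
        by simp⟩

/-- Corners of `S` and `T` cross fewer members of a laminar family containing `T`. -/
theorem NestedOrDisjoint.corner {α : Type*} {S T X Y : Finset α} (hST : ¬ NestedOrDisjoint S T)
    (hX : X = S ∩ T ∨ X = T \ S ∨ X = S \ T ∨ X = S ∪ T) (hYT : NestedOrDisjoint Y T)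
    (hSY : NestedOrDisjoint S Y) : NestedOrDisjoint X Y := by
  by_contra hc
  revert hSY
  obtain ⟨⟨a, haS, haT⟩, ⟨b, hbT, hbS⟩, c, hcS, hcT⟩ := not_nestedOrDisjoint_iff.1 hST
  obtain ⟨⟨x, hx, hx'⟩, ⟨y, hy, hy'⟩, z, hz, hz'⟩ := not_nestedOrDisjoint_iff.1 hc
  rw [imp_false, not_nestedOrDisjoint_iff]
  rcases hYT with h | h | h
  · rcases hX with rfl | rfl | rfl | rfl <;> simp only [subset_iff] at * <;> grind
  · rcases hX with rfl | rfl | rfl | rfl <;> simp only [subset_iff] at * <;> grind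
  · rw [disjoint_left] at h
    rcases hX with rfl | rfl | rfl | rfl <;> grind

theorem NestedOrDisjoint.corner_self {α : Type*} {S T X : Finset α}
    (hX : X = S ∩ T ∨ X = T \ S ∨ X = S \ T ∨ X = S ∪ T) : NestedOrDisjoint X T := by
  rcases hX with rfl | rfl | rfl | rfl
  · exact Or.inl inter_subset_right
  · exact Or.inl sdiff_subset
  · exact Or.inr (Or.inr sdiff_disjoint)
  · exact Or.inr (Or.inl subset_union_right)

/-- A laminar family of nontrivial minimum cuts separating every pair of vertices that some
nontrivial minimum cut separates. -/
theorem exists_laminar_separating {G : SimpleGraph V} (hδ : 3 ≤ G.minDegree) (r : V) :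
    ∃ L : Finset (Finset V), IsLaminar L ∧ (∀ S ∈ L, IsNontrivialMinCut G S) ∧
      ∀ S, IsNontrivialMinCut G S → ∀ u v, (∀ T ∈ L, u ∈ T ↔ v ∈ T) → (u ∈ S ↔ v ∈ S) := by
  obtain ⟨L, hL⟩ := (univ.filter fun L : Finset (Finset V) =>
    IsLaminar L ∧ ∀ S ∈ L, IsNontrivialMinCut G S ∧ r ∉ S).exists_maximal
      ⟨∅, mem_filter.2 ⟨mem_univ _, fun A hA => absurd hA (notMem_empty A),
        fun A hA => absurd hA (notMem_empty A)⟩⟩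
  obtain ⟨hlam, hcut⟩ := (mem_filter.1 hL.prop).2
  refine ⟨L, hlam, fun S hS => (hcut S hS).1, ?_⟩
  have main : ∀ k, ∀ S, IsNontrivialMinCut G S → r ∉ S →
      (L.filter fun T => ¬ NestedOrDisjoint S T).card = k →
      ∀ u v, (∀ T ∈ L, u ∈ T ↔ v ∈ T) → u ∈ S → v ∈ S := by
    intro k
    induction k using Nat.strong_induction_on with
    | _ k ih =>
    intro S hS hr hk u v huv hu
    by_contra hv
    rcases (L.filter fun T => ¬ NestedOrDisjoint S T).eq_empty_or_nonempty with he | ⟨T, hT⟩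
    · have hall : ∀ T ∈ L, NestedOrDisjoint S T := by simpa [filter_eq_empty_iff] using he
      have hins : insert S L ≤ L := by
        refine hL.le_of_ge (mem_filter.2 ⟨mem_univ _, ?_, ?_⟩) (subset_insert S L)
        · intro A hA B hB
          rcases mem_insert.1 hA with hAS | hAL <;> rcases mem_insert.1 hB with hBS | hBL
          · exact Or.inl (hAS.trans hBS.symm).subset
          · exact hAS ▸ hall B hBL
          · exact hBS ▸ (hall A hAL).symm
          · exact hlam A hAL B hBL
        · intro A hA
          rcases mem_insert.1 hA with rfl | hA
          · exact ⟨hS, hr⟩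
          · exact hcut A hA
      exact hv ((huv S (hins (mem_insert_self S L))).1 hu)
    · obtain ⟨hTL, hST⟩ := mem_filter.1 hT
      obtain ⟨X, hX, hrX, hsep, hcor⟩ := exists_uncrossing hδ hS (hcut T hTL).1 hr
        (hcut T hTL).2 hu hv (huv T hTL) hST
      have hlt : (L.filter fun T => ¬ NestedOrDisjoint X T).card < k := by
        rw [← hk]
        refine card_lt_card ((ssubset_iff_of_subset ?_).2 ⟨T, hT, ?_⟩)
        · intro Y hY
          obtain ⟨hYL, hXY⟩ := mem_filter.1 hY
          exact mem_filter.2 ⟨hYL, fun h =>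
            hXY (NestedOrDisjoint.corner hST hcor (hlam Y hYL T hTL) h)⟩
        · intro h
          exact (mem_filter.1 h).2 (NestedOrDisjoint.corner_self hcor)
      exact hsep ⟨ih _ hlt X hX hrX rfl u v huv,
        ih _ hlt X hX hrX rfl v u fun T hT => (huv T hT).symm⟩
  intro S hS u v huv
  by_cases hr : r ∈ S
  · have h1 := main _ Sᶜ hS.compl (by simpa using hr) rfl u v huv
    have h2 := main _ Sᶜ hS.compl (by simpa using hr) rfl v u fun T hT => (huv T hT).symm
    simp only [mem_compl] at h1 h2
    tauto
  · exact ⟨main _ S hS hr rfl u v huv, main _ S hS hr rfl v u fun T hT => (huv T hT).symm⟩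

theorem crossEdges_atoms_subset (G : SimpleGraph V) (L : Finset (Finset V)) :
    crossEdges G (atoms L) ⊆ L.biUnion (bdry G) := by
  intro e
  induction e with | _ u v
  intro he
  simp only [crossEdges, mem_filter, SimpleGraph.mem_edgeFinset, SimpleGraph.mem_edgeSet] at he
  obtain ⟨hadj, hno⟩ := he
  by_contra hc
  simp only [mem_biUnion, mem_bdry, not_exists, not_and] at hc
  refine hno ⟨_, mem_image_of_mem _ (mem_univ u), ?_⟩
  intro x hx
  simp only [mem_filter, mem_univ, true_and]
  rcases Sym2.mem_iff.1 hx with rfl | rfl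
  · simp
  · intro S hS
    have := hc S hS hadj
    tauto

theorem card_mul_minDegree_le_two_mul_card_edgeFinset (G : SimpleGraph V) :
    Fintype.card V * G.minDegree ≤ 2 * G.edgeFinset.card := by
  rw [← G.sum_degrees_eq_twice_card_edges, ← card_univ, ← smul_eq_mul]
  exact card_nsmul_le_sum _ _ _ fun v _ => G.minDegree_le_degree v

theorem exists_partition_of_connected (G : SimpleGraph V) (hG : G.Connected)
    (hδ : 1 ≤ G.minDegree) :
    ∃ P : Finset (Finset V), IsPartition P ∧
      (∀ S : Finset V, IsNontrivialMinCut G S → ∀ p ∈ P, p ⊆ S ∨ Disjoint p S) ∧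
      (crossEdges G P).card * G.minDegree ≤ 12 * G.edgeFinset.card ∧
      P.card * G.minDegree ≤ 12 * Fintype.card V := by
  obtain ⟨r⟩ := hG.nonempty
  have of_separating : ∀ L : Finset (Finset V), (∀ S, IsNontrivialMinCut G S →
      ∀ u v, (∀ T ∈ L, u ∈ T ↔ v ∈ T) → (u ∈ S ↔ v ∈ S)) →
      ∀ S : Finset V, IsNontrivialMinCut G S → ∀ p ∈ atoms L, p ⊆ S ∨ Disjoint p S := by
    intro L hL S hS p hp
    obtain ⟨u, -, rfl⟩ := mem_image.1 hp
    by_cases hu : u ∈ S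
    · left
      intro v hv
      exact (hL S hS u v (mem_filter.1 hv).2).1 hu
    · right
      rw [disjoint_left]
      intro v hv hvS
      exact hu ((hL S hS u v (mem_filter.1 hv).2).2 hvS)
  rcases Nat.lt_or_ge G.minDegree 3 with h3 | h3
  · refine ⟨atoms univ, isPartition_atoms _,
      of_separating _ fun S _ u v h => h S (mem_univ S), ?_, ?_⟩
    · have hle : ∀ P, (crossEdges G P).card ≤ G.edgeFinset.card := fun P =>
        card_le_card (filter_subset _ _)
      calc _ ≤ G.edgeFinset.card * 12 := Nat.mul_le_mul (hle _) (by omega)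
        _ = _ := mul_comm _ _
    · have hle : (atoms (univ : Finset (Finset V))).card ≤ Fintype.card V := card_image_le
      calc _ ≤ Fintype.card V * 12 := Nat.mul_le_mul hle (by omega)
        _ = _ := mul_comm _ _
  · obtain ⟨L, hlam, hcut, hsep⟩ := exists_laminar_separating h3 r
    refine ⟨atoms L, isPartition_atoms L, of_separating L hsep, ?_⟩
    have hL : L.Nonempty → G.minDegree * (L.card + 3) ≤ 6 * Fintype.card V := fun hne =>
      (hlam.card_bound hδ L hne (fun A hA => (hcut A hA).minDegree_le_card hδ)
        fun A hA B _ C _ D hD => minDegree_add_card_le_of_chain hδ (hcut A hA).2.2.1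
          (hcut D hD).2.2.1).trans (Nat.mul_le_mul_left _ (card_le_univ _))
    have hdn : G.minDegree ≤ Fintype.card V :=
      (G.minDegree_le_degree r).trans (G.degree_lt_card_verts r).le
    have hcard : (L.card + 1) * G.minDegree ≤ 6 * Fintype.card V := by
      rcases L.eq_empty_or_nonempty with rfl | hne
      · rw [card_empty]; omega
      · nlinarith [hL hne]
    have hcross : (crossEdges G (atoms L)).card ≤ L.card * G.minDegree :=
      (card_le_card (crossEdges_atoms_subset G L)).trans <| card_biUnion_le_card_mul _ _ _
        fun S hS => (hcut S hS).2.2.1.trans_le (econn_le_minDegree G hδ)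
    have hm := card_mul_minDegree_le_two_mul_card_edgeFinset G
    constructor
    · have h1 := Nat.mul_le_mul_right G.minDegree hcross
      have h2 := Nat.mul_le_mul_right G.minDegree hcard
      nlinarith
    · have := Nat.mul_le_mul_right G.minDegree hlam.card_atoms_le
      omega

theorem stmt0 :
    ∃ C c : ℝ, 0 < C ∧ 1 ≤ c ∧
      ∀ (V : Type) [Fintype V], ∀ (G : SimpleGraph V) (n m δ : ℕ),
        G.Connected →
        n = Fintype.card V →
        m = G.edgeFinset.card →
        δ = G.minDegree →
        1 ≤ δ →
        ∃ P : Finset (Finset V),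
          IsPartition P ∧
          (∀ S : Finset V, IsNontrivialMinCut G S →
            ∀ p ∈ P, p ⊆ S ∨ Disjoint p S) ∧
          ((crossEdges G P).card : ℝ) ≤ C * m * Real.log ((n : ℝ) + 2) ^ c / δ ∧
          (P.card : ℝ) ≤ C * n * Real.log ((n : ℝ) + 2) ^ c / δ := by
  refine ⟨12, 1, by norm_num, le_refl _, ?_⟩
  intro V _ G n m δ hG hn hm hδ hδ1
  obtain ⟨P, hP, hS, h1, h2⟩ := exists_partition_of_connected G hG (hδ ▸ hδ1)
  rw [← hδ, ← hm] at h1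
  rw [← hδ, ← hn] at h2
  have : Nonempty V := hG.nonempty
  have hn1 : (1 : ℝ) ≤ n := by
    rw [hn]; exact_mod_cast Fintype.card_pos
  have hlog : 1 ≤ Real.log ((n : ℝ) + 2) := by
    rw [Real.le_log_iff_exp_le (by linarith)]
    linarith [Real.exp_one_lt_three]
  have hδ0 : (0 : ℝ) < δ := by exact_mod_cast hδ1
  refine ⟨P, hP, hS, ?_, ?_⟩
  · rw [le_div_iff₀ hδ0, Real.rpow_one]
    calc ((crossEdges G P).card : ℝ) * δ ≤ 12 * m := by exact_mod_cast h1
      _ ≤ 12 * m * Real.log ((n : ℝ) + 2) := le_mul_of_one_le_right (by positivity) hlog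
  · rw [le_div_iff₀ hδ0, Real.rpow_one]
    calc (P.card : ℝ) * δ ≤ 12 * n := by exact_mod_cast h2
      _ ≤ 12 * n * Real.log ((n : ℝ) + 2) := le_mul_of_one_le_right (by positivity) hlog

end
end

section
/- There exist absolute constants C > 0 and c ≥ 1 with the following property. For every finite simple connected graph G on vertex set V with n vertices and minimum degree δ ≥ 1, the number of non-trivial minimum cuts of G — that is, the number of unordered partitions {S, V∖S} of V with |S| ≥ 2, |V∖S| ≥ 2, and |∂S| = λ(G) — is at most C·(n/δ)²·(log(n+2))^c. -/
open scoped Classical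
open Finset

noncomputable section

variable {V : Type*} [Fintype V]

/-! ### Cuts as sets of ordered pairs -/

/-- The ordered pairs of adjacent vertices leading from `S` to its complement. -/
def cutPairs (G : SimpleGraph V) (S : Finset V) : Finset (V × V) :=
  univ.filter fun p => p.1 ∈ S ∧ p.2 ∉ S ∧ G.Adj p.1 p.2

lemma mem_cutPairs {G : SimpleGraph V} {S : Finset V} {p : V × V} :
    p ∈ cutPairs G S ↔ p.1 ∈ S ∧ p.2 ∉ S ∧ G.Adj p.1 p.2 := by
  simp [cutPairs]

lemma card_bdry_eq_card_cutPairs (G : SimpleGraph V) (S : Finset V) :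
    (bdry G S).card = (cutPairs G S).card := by
  have h : bdry G S = (cutPairs G S).image fun p => s(p.1, p.2) := by
    ext e
    simp only [bdry, mem_filter, mem_image, mem_cutPairs, SimpleGraph.mem_edgeFinset, Prod.exists]
    constructor
    · rintro ⟨he, u, v, hu, hv, rfl⟩
      exact ⟨u, v, ⟨hu, hv, by simpa using he⟩, rfl⟩
    · rintro ⟨u, v, ⟨hu, hv, ha⟩, rfl⟩
      exact ⟨by simpa using ha, u, v, hu, hv, rfl⟩
  rw [h, card_image_of_injOn]
  rintro ⟨a, b⟩ hp ⟨c, d⟩ hq heq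
  simp only [mem_coe, mem_cutPairs] at hp hq
  rcases Sym2.eq_iff.1 heq with ⟨h1, h2⟩ | ⟨h1, h2⟩
  · simp_all
  · simp_all

lemma card_cutPairs_compl (G : SimpleGraph V) (S : Finset V) :
    (cutPairs G Sᶜ).card = (cutPairs G S).card := by
  refine card_bij (fun p _ => p.swap) ?_ ?_ ?_
  · intro p hp
    simp only [mem_cutPairs, mem_compl, not_not, Prod.fst_swap, Prod.snd_swap] at hp ⊢
    exact ⟨hp.2.1, hp.1, hp.2.2.symm⟩
  · intro p _ q _ h
    exact Prod.swap_injective h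
  · intro p hp
    refine ⟨p.swap, ?_, Prod.swap_swap p⟩
    simp only [mem_cutPairs, mem_compl, not_not, Prod.fst_swap, Prod.snd_swap] at hp ⊢
    exact ⟨hp.2.1, hp.1, hp.2.2.symm⟩

lemma econn_le_card_cutPairs (G : SimpleGraph V) {S : Finset V} (hS : S.Nonempty)
    (hS' : S ≠ univ) : econn G ≤ (cutPairs G S).card :=
  Nat.sInf_le ⟨S, hS, hS', card_bdry_eq_card_cutPairs G S⟩

lemma cutPairs_nonempty {G : SimpleGraph V} (hG : G.Connected) {S : Finset V} (hS : S.Nonempty)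
    (hS' : S ≠ univ) : (cutPairs G S).Nonempty := by
  obtain ⟨u, hu⟩ := hS
  obtain ⟨v, hv⟩ : ∃ v, v ∉ S := by
    by_contra! h
    exact hS' (eq_univ_iff_forall.2 h)
  obtain ⟨w⟩ := hG.preconnected u v
  obtain ⟨d, -, h1, h2⟩ := w.exists_boundary_dart (S : Set V) (by simpa using hu)
    (by simpa using hv)
  exact ⟨(d.fst, d.snd), mem_cutPairs.2 ⟨by simpa using h1, by simpa using h2, d.adj⟩⟩

lemma econn_pos {G : SimpleGraph V} (hG : G.Connected) {S : Finset V} (hS : S.Nonempty)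
    (hS' : S ≠ univ) : 0 < econn G := by
  obtain ⟨T, hT, hT', h⟩ :=
    Nat.sInf_mem (s := {k | ∃ S : Finset V, S.Nonempty ∧ S ≠ univ ∧ (bdry G S).card = k})
      ⟨_, S, hS, hS', rfl⟩
  change (bdry G T).card = econn G at h
  rw [← h, card_bdry_eq_card_cutPairs]
  exact (cutPairs_nonempty hG hT hT').card_pos

/-- The neighbours of `v` on the other side of the cut `S`. -/
def crossNbrs (G : SimpleGraph V) (S : Finset V) (v : V) : Finset V :=
  (G.neighborFinset v).filter fun w => ¬(w ∈ S ↔ v ∈ S)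

/-- The neighbours of `v` on the same side of the cut `S`. -/
def sameNbrs (G : SimpleGraph V) (S : Finset V) (v : V) : Finset V :=
  (G.neighborFinset v).filter fun w => w ∈ S ↔ v ∈ S

lemma card_sameNbrs_add_card_crossNbrs (G : SimpleGraph V) (S : Finset V) (v : V) :
    (sameNbrs G S v).card + (crossNbrs G S v).card = G.degree v := by
  rw [← G.card_neighborFinset_eq_degree v]
  exact card_filter_add_card_filter_not _

lemma sum_card_crossNbrs (G : SimpleGraph V) (S : Finset V) :
    ∑ v, (crossNbrs G S v).card = 2 * (cutPairs G S).card := by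
  have h1 : ∀ T : Finset V, ∑ v ∈ T, (crossNbrs G T v).card = (cutPairs G T).card := by
    intro T
    rw [← card_sigma]
    refine card_bij (fun p _ => (p.1, p.2)) ?_ ?_ ?_
    · rintro ⟨a, b⟩ h
      simp only [mem_sigma, crossNbrs, mem_filter, SimpleGraph.mem_neighborFinset] at h
      exact mem_cutPairs.2 ⟨h.1, by tauto, h.2.1⟩
    · rintro ⟨a, b⟩ _ ⟨c, d⟩ _ h
      simpa using h
    · rintro ⟨a, b⟩ h
      have h := mem_cutPairs.1 h
      refine ⟨⟨a, b⟩, ?_, rfl⟩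
      simp only [mem_sigma, crossNbrs, mem_filter, SimpleGraph.mem_neighborFinset]
      exact ⟨h.1, h.2.2, by tauto⟩
  have h2 : ∀ v, crossNbrs G Sᶜ v = crossNbrs G S v := by
    intro v
    ext w
    simp only [crossNbrs, mem_filter, mem_compl]
    tauto
  rw [← sum_add_sum_compl S, h1]
  simp_rw [← h2]
  rw [h1, card_cutPairs_compl]
  ring

lemma econn_le_degree (G : SimpleGraph V) (v : V) (hV : 2 ≤ Fintype.card V) :
    econn G ≤ G.degree v := by
  refine (econn_le_card_cutPairs G (singleton_nonempty v) ?_).trans ?_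
  · intro h
    have := congrArg card h
    rw [card_singleton, card_univ] at this
    omega
  · rw [← G.card_neighborFinset_eq_degree v]
    refine card_le_card_of_injOn Prod.snd ?_ ?_
    · rintro ⟨a, b⟩ h
      obtain ⟨h1, -, h3⟩ := mem_cutPairs.1 (mem_coe.1 h)
      obtain rfl : a = v := by simpa using h1
      simpa using h3
    · rintro ⟨a, b⟩ h ⟨c, d⟩ h' hbd
      have h1 := (mem_cutPairs.1 (mem_coe.1 h)).1
      have h2 := (mem_cutPairs.1 (mem_coe.1 h')).1
      simp only [mem_singleton] at h1 h2 hbd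
      rw [h1, h2, hbd]

/-- In a minimum cut no vertex of a side with at least two vertices has most of its neighbours on
the other side, as moving that vertex would decrease the cut. -/
lemma card_crossNbrs_le_card_sameNbrs_of_mem {G : SimpleGraph V} {S : Finset V}
    (hS : 2 ≤ S.card) (hmin : (cutPairs G S).card = econn G) {v : V} (hv : v ∈ S) :
    (crossNbrs G S v).card ≤ (sameNbrs G S v).card := by
  have hne : (S.erase v).Nonempty := by
    rw [← card_pos, card_erase_of_mem hv]
    omega
  have hle := econn_le_card_cutPairs G hne fun h => by
    have : v ∈ S.erase v := h ▸ mem_univ v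
    simp at this
  let out := (crossNbrs G S v).image fun w => (v, w)
  have hout : out.card = (crossNbrs G S v).card :=
    card_image_of_injective _ fun a b h => by simpa using h
  have hsub : out ⊆ cutPairs G S := by
    intro p hp
    obtain ⟨w, hw, rfl⟩ := mem_image.1 hp
    simp only [crossNbrs, mem_filter, SimpleGraph.mem_neighborFinset] at hw
    exact mem_cutPairs.2 ⟨hv, by tauto, hw.1⟩
  have hcov : cutPairs G (S.erase v) ⊆
      (cutPairs G S \ out) ∪ (sameNbrs G S v).image fun w => (w, v) := by
    rintro ⟨a, b⟩ h
    simp only [mem_cutPairs, mem_erase, not_and] at h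
    obtain ⟨⟨hav, haS⟩, hb, hab⟩ := h
    simp only [mem_union, mem_sdiff, mem_cutPairs, mem_image, Prod.mk.injEq, out, sameNbrs,
      mem_filter, SimpleGraph.mem_neighborFinset]
    by_cases hbv : b = v
    · subst hbv
      exact Or.inr ⟨a, ⟨hab.symm, by tauto⟩, rfl, rfl⟩
    · refine Or.inl ⟨⟨haS, hb hbv, hab⟩, ?_⟩
      rintro ⟨w, -, h, -⟩
      exact hav h.symm
  have h1 := card_le_card hcov
  have h2 := card_union_le (cutPairs G S \ out) ((sameNbrs G S v).image fun w => (w, v))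
  have h3 := card_sdiff_add_card_eq_card hsub
  have h4 : ((sameNbrs G S v).image fun w => (w, v)).card ≤ _ := card_image_le
  omega

lemma card_crossNbrs_le_card_sameNbrs {G : SimpleGraph V} {S : Finset V}
    (hS : 2 ≤ S.card) (hS' : 2 ≤ Sᶜ.card) (hmin : (cutPairs G S).card = econn G) (v : V) :
    (crossNbrs G S v).card ≤ (sameNbrs G S v).card := by
  by_cases hv : v ∈ S
  · exact card_crossNbrs_le_card_sameNbrs_of_mem hS hmin hv
  · have h := card_crossNbrs_le_card_sameNbrs_of_mem hS'
      ((card_cutPairs_compl G S).trans hmin) (mem_compl.2 hv)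
    have h1 : crossNbrs G Sᶜ v = crossNbrs G S v := by
      ext w
      simp only [crossNbrs, mem_filter, mem_compl]
      tauto
    have h2 : sameNbrs G Sᶜ v = sameNbrs G S v := by
      ext w
      simp only [sameNbrs, mem_filter, mem_compl]
      tauto
    rwa [h1, h2] at h

/-! ### Counting minimum cuts compatible with a partition -/

/-- The sets with `lam` boundary edges that are unions of fibres of `φ`. -/
def saturatedCuts {α : Type*} (G : SimpleGraph V) (lam : ℕ) (φ : V → α) : Finset (Finset V) :=
  univ.filter fun S => (cutPairs G S).card = lam ∧ ∀ u v, φ u = φ v → (u ∈ S ↔ v ∈ S)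

lemma mem_saturatedCuts {α : Type*} {G : SimpleGraph V} {lam : ℕ} {φ : V → α} {S : Finset V} :
    S ∈ saturatedCuts G lam φ ↔
      (cutPairs G S).card = lam ∧ ∀ u v, φ u = φ v → (u ∈ S ↔ v ∈ S) := by
  simp [saturatedCuts]

lemma card_saturatedCuts_le_two_pow {α : Type*} [DecidableEq α] (G : SimpleGraph V) (lam : ℕ)
    (φ : V → α) :
    (saturatedCuts G lam φ).card ≤ 2 ^ (univ.image φ).card := by
  rw [← card_powerset]
  refine card_le_card_of_injOn (fun S => S.image φ) ?_ ?_
  · intro S _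
    simp
  · have key : ∀ S ∈ saturatedCuts G lam φ, ∀ v, v ∈ S ↔ φ v ∈ S.image φ := by
      intro S hS v
      refine ⟨fun h => mem_image_of_mem _ h, fun h => ?_⟩
      obtain ⟨u, hu, huv⟩ := mem_image.1 h
      exact ((mem_saturatedCuts.1 hS).2 u v huv).1 hu
    intro S hS T hT h
    ext v
    have h : S.image φ = T.image φ := h
    rw [key S hS, key T hT, h]

/-- The averaging form of Karger's contraction argument. -/
lemma card_saturatedCuts_le_aux {α : Type*} [DecidableEq α] (G : SimpleGraph V) {lam : ℕ}
    (hlam : 0 < lam)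
    (hmin : ∀ S : Finset V, S.Nonempty → S ≠ univ → lam ≤ (cutPairs G S).card)
    (k : ℕ) (hk : 2 ≤ k) :
    ∀ φ : V → α, (univ.image φ).card = k →
      (saturatedCuts G lam φ).card ≤ 2 * k * (k - 1) := by
  induction k, hk using Nat.le_induction with
  | base =>
    intro φ hφ
    simpa [hφ] using card_saturatedCuts_le_two_pow G lam φ
  | succ k hk ih =>
    intro φ hφ
    let D : Finset (V × V) := univ.filter fun p => G.Adj p.1 p.2 ∧ φ p.1 ≠ φ p.2
    have hD : (k + 1) * lam ≤ D.card := by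
      have h1 : D.card = ∑ a ∈ univ.image φ, (D.filter fun p => φ p.1 = a).card :=
        card_eq_sum_card_fiberwise fun p _ => by simp
      rw [h1, ← hφ, ← smul_eq_mul]
      refine card_nsmul_le_sum _ _ _ fun a ha => ?_
      obtain ⟨x, -, hx⟩ := mem_image.1 ha
      have h2 : (D.filter fun p => φ p.1 = a) = cutPairs G (univ.filter fun v => φ v = a) := by
        ext p
        simp only [D, mem_filter, mem_univ, true_and, mem_cutPairs]
        constructor
        · rintro ⟨⟨h1, h2⟩, h3⟩
          exact ⟨h3, fun h => h2 (h3.trans h.symm), h1⟩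
        · rintro ⟨h1, h2, h3⟩
          exact ⟨⟨h3, fun h => h2 (h ▸ h1)⟩, h1⟩
      rw [h2]
      refine hmin _ ⟨x, by simpa using hx⟩ fun h => ?_
      have h3 : univ.image φ ⊆ {a} := by
        intro b hb
        obtain ⟨y, -, rfl⟩ := mem_image.1 hb
        simpa using eq_univ_iff_forall.1 h y
      have := card_le_card h3
      rw [hφ, card_singleton] at this
      omega
    let 𝓜 := saturatedCuts G lam φ
    have hdc : ∑ p ∈ D, (𝓜.filter fun S => p.1 ∈ S ↔ p.2 ∈ S).card =
        ∑ S ∈ 𝓜, (D.filter fun p => p.1 ∈ S ↔ p.2 ∈ S).card :=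
      sum_card_bipartiteAbove_eq_sum_card_bipartiteBelow _
    have hup : ∑ p ∈ D, (𝓜.filter fun S => p.1 ∈ S ↔ p.2 ∈ S).card ≤
        D.card * (2 * k * (k - 1)) := by
      rw [← smul_eq_mul]
      refine sum_le_card_nsmul _ _ _ fun p hp => ?_
      have hp : G.Adj p.1 p.2 ∧ φ p.1 ≠ φ p.2 := by simpa [D] using hp
      let ψ : V → α := fun x => if φ x = φ p.1 then φ p.2 else φ x
      have hψ : univ.image ψ = (univ.image φ).erase (φ p.1) := by
        ext a
        simp only [mem_image, mem_univ, true_and, mem_erase, ψ]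
        constructor
        · rintro ⟨x, rfl⟩
          split_ifs with h
          · exact ⟨hp.2.symm, p.2, rfl⟩
          · exact ⟨h, x, rfl⟩
        · rintro ⟨h, x, rfl⟩
          exact ⟨x, if_neg h⟩
      refine (card_le_card ?_).trans (ih ψ ?_)
      · intro S hS
        obtain ⟨hS, hpS⟩ := mem_filter.1 hS
        obtain ⟨hS1, hS2⟩ := mem_saturatedCuts.1 hS
        refine mem_saturatedCuts.2 ⟨hS1, fun u v huv => ?_⟩
        simp only [ψ] at huv
        split_ifs at huv with h1 h2 h2
        · exact hS2 _ _ (h1.trans h2.symm)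
        · rw [hS2 _ _ h1, hpS, hS2 _ _ huv]
        · rw [hS2 _ _ huv, ← hpS, hS2 _ _ h2]
        · exact hS2 _ _ huv
      · rw [hψ, card_erase_of_mem (mem_image_of_mem _ (mem_univ _)), hφ]
        rfl
    have hlow : 𝓜.card * (D.card - 2 * lam) ≤
        ∑ S ∈ 𝓜, (D.filter fun p => p.1 ∈ S ↔ p.2 ∈ S).card := by
      rw [← smul_eq_mul]
      refine card_nsmul_le_sum _ _ _ fun S hS => ?_
      obtain ⟨hS1, -⟩ := mem_saturatedCuts.1 hS
      have h1 := card_filter_add_card_filter_not (s := D) fun p : V × V => p.1 ∈ S ↔ p.2 ∈ S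
      have h2 : (D.filter fun p => ¬(p.1 ∈ S ↔ p.2 ∈ S)) ⊆ cutPairs G S ∪
          (cutPairs G Sᶜ) := by
        intro p hp
        simp only [D, mem_filter, mem_univ, true_and] at hp
        simp only [mem_union, mem_cutPairs, mem_compl]
        tauto
      have h3 := (card_le_card h2).trans (card_union_le _ _)
      rw [card_cutPairs_compl] at h3
      omega
    have hfin := (hlow.trans_eq hdc.symm).trans hup
    change 𝓜.card ≤ _
    obtain ⟨j, rfl⟩ : ∃ j, k = j + 1 := ⟨k - 1, by omega⟩
    obtain ⟨d, hd⟩ : ∃ d, D.card = 2 * lam + d :=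
      Nat.exists_eq_add_of_le (by nlinarith)
    simp only [hd, Nat.add_sub_cancel_left, Nat.add_sub_cancel] at hfin hD ⊢
    have hj : 0 < j := by omega
    have hpos : 0 < (2 * lam + d) * j := by positivity
    refine Nat.le_of_mul_le_mul_right ?_ hpos
    calc 𝓜.card * ((2 * lam + d) * j) ≤ 𝓜.card * (d * (j + 2)) :=
          Nat.mul_le_mul_left _ (by nlinarith)
      _ = (𝓜.card * d) * (j + 2) := by ring
      _ ≤ ((2 * lam + d) * (2 * (j + 1) * j)) * (j + 2) := Nat.mul_le_mul_right _ hfin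
      _ = 2 * (j + 1 + 1) * (j + 1) * ((2 * lam + d) * j) := by ring

lemma card_saturatedCuts_le {α : Type*} [DecidableEq α] [Nonempty V] (G : SimpleGraph V) {lam : ℕ}
    (hlam : 0 < lam)
    (hmin : ∀ S : Finset V, S.Nonempty → S ≠ univ → lam ≤ (cutPairs G S).card) (φ : V → α) :
    (saturatedCuts G lam φ).card ≤ 2 * (univ.image φ).card ^ 2 := by
  have hpos : 0 < (univ.image φ).card := (univ_nonempty.image φ).card_pos
  rcases Nat.lt_or_ge (univ.image φ).card 2 with h | h
  · have h1 : (univ.image φ).card = 1 := by omega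
    simpa [h1] using card_saturatedCuts_le_two_pow G lam φ
  · refine (card_saturatedCuts_le_aux G hlam hmin _ h φ rfl).trans ?_
    rw [pow_two, mul_assoc]
    gcongr
    omega

/-! ### Components of a functional graph -/

/-- Two points are related if their forward orbits under `f` meet. -/
def orbitSetoid (f : V → V) : Setoid V where
  r u v := ∃ a b, f^[a] u = f^[b] v
  iseqv :=
    { refl := fun _ => ⟨0, 0, rfl⟩
      symm := fun ⟨a, b, h⟩ => ⟨b, a, h.symm⟩
      trans := by
        rintro u v w ⟨a, b, h⟩ ⟨c, d, h'⟩
        refine ⟨c + a, b + d, ?_⟩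
        rw [Function.iterate_add_apply, h, ← Function.iterate_add_apply, add_comm c b,
          Function.iterate_add_apply, h', ← Function.iterate_add_apply] }

/-- The map sending a point to its component in the functional graph of `f`. -/
def componentMk (f : V → V) : V → Quotient (orbitSetoid f) :=
  Quotient.mk (orbitSetoid f)

lemma componentMk_eq_iff {W : Type*} {f : W → W} {u v : W} :
    componentMk f u = componentMk f v ↔ ∃ a b, f^[a] u = f^[b] v :=
  Quotient.eq (r := orbitSetoid f)

/-- The number of components of the functional graph of `f`. -/
def componentCount (f : V → V) : ℕ :=
  (univ.image (componentMk f)).card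

lemma mem_iff_of_componentMk_eq {W : Type*} {f : W → W} {S : Finset W}
    (hS : ∀ v, f v ∈ S ↔ v ∈ S) {u v : W} (huv : componentMk f u = componentMk f v) :
    u ∈ S ↔ v ∈ S := by
  have key : ∀ a x, f^[a] x ∈ S ↔ x ∈ S := by
    intro a x
    induction a with
    | zero => rfl
    | succ a ih => rw [Function.iterate_succ_apply', hS, ih]
  obtain ⟨a, b, h⟩ := componentMk_eq_iff.1 huv
  rw [← key a u, h, key b v]

lemma exists_iterate_mem_periodicPts (f : V → V) (v : V) :
    ∃ a, f^[a] v ∈ Function.periodicPts f := by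
  obtain ⟨a, b, hab, h⟩ := Finite.exists_ne_map_eq_of_infinite fun a : ℕ => f^[a] v
  have key : ∀ a b : ℕ, a < b → f^[a] v = f^[b] v → ∃ a, f^[a] v ∈ Function.periodicPts f := by
    intro a b hab h
    refine ⟨a, Function.mk_mem_periodicPts (Nat.sub_pos_of_lt hab) ?_⟩
    change f^[b - a] (f^[a] v) = f^[a] v
    rw [← Function.iterate_add_apply, Nat.sub_add_cancel hab.le, h]
  rcases hab.lt_or_gt with hlt | hlt
  · exact key a b hlt h
  · exact key b a hlt h.symm

/-- Each component contains a cycle, whose points contribute `1` in total to the sum. -/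
lemma componentCount_le_sum (f : V → V) :
    (componentCount f : ℝ) ≤ ∑ v, (1 : ℝ) / Function.minimalPeriod f v := by
  rw [← sum_fiberwise_of_maps_to (s := univ) (t := univ.image (componentMk f))
    (g := componentMk f) fun v _ => mem_image_of_mem _ (mem_univ v), componentCount,
    ← nsmul_one]
  refine card_nsmul_le_sum _ _ _ fun q hq => ?_
  obtain ⟨v, -, rfl⟩ := mem_image.1 hq
  obtain ⟨a, ha⟩ := exists_iterate_mem_periodicPts f v
  set p := f^[a] v with hp
  have hpos := Function.minimalPeriod_pos_of_mem_periodicPts ha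
  let O : Finset V := (range (Function.minimalPeriod f p)).image fun k => f^[k] p
  have hO : O.card = Function.minimalPeriod f p := by
    rw [card_image_of_injOn, card_range]
    simpa using Function.iterate_injOn_Iio_minimalPeriod (f := f) (x := p)
  have hsub : O ⊆ univ.filter fun u => componentMk f u = componentMk f v := by
    intro u hu
    obtain ⟨k, -, rfl⟩ := mem_image.1 hu
    simp only [mem_filter, mem_univ, true_and, componentMk_eq_iff]
    exact ⟨0, k + a, by rw [Function.iterate_add_apply]; rfl⟩
  calc (1 : ℝ) = ∑ u ∈ O, (1 : ℝ) / Function.minimalPeriod f u := by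
        rw [sum_congr rfl (g := fun _ => (1 : ℝ) / Function.minimalPeriod f p), sum_const, hO,
          nsmul_eq_mul, mul_one_div_cancel (by positivity)]
        intro u hu
        obtain ⟨k, -, rfl⟩ := mem_image.1 hu
        rw [Function.minimalPeriod_apply_iterate ha]
    _ ≤ _ := sum_le_sum_of_subset_of_nonneg hsub fun _ _ _ => by positivity

/-! ### Random neighbour choices -/

/-- The functions sending every vertex to one of its neighbours. -/
def neighborChoices (G : SimpleGraph V) : Finset (V → V) :=
  Fintype.piFinset fun v => G.neighborFinset v

lemma mem_neighborChoices {G : SimpleGraph V} {f : V → V} :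
    f ∈ neighborChoices G ↔ ∀ v, G.Adj v (f v) := by
  simp [neighborChoices]

lemma card_neighborChoices (G : SimpleGraph V) :
    (neighborChoices G).card = ∏ v, G.degree v := by
  simp [neighborChoices]

/-- Resampling the last vertex of the cycle through `v` shows that a uniformly random neighbour
choice has a cycle of length `l` through `v` with probability at most `1 / δ`. -/
lemma card_filter_minimalPeriod_mul_le {G : SimpleGraph V} {δ : ℕ} (hδ : ∀ v, δ ≤ G.degree v)
    (v : V) {l : ℕ} (hl : 1 ≤ l) :
    ((neighborChoices G).filter fun f => Function.minimalPeriod f v = l).card * δ ≤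
      (neighborChoices G).card := by
  set A := (neighborChoices G).filter fun f => Function.minimalPeriod f v = l with hA
  have hmem : ∀ {f}, f ∈ A → (∀ x, G.Adj x (f x)) ∧ Function.minimalPeriod f v = l := by
    intro f hf
    rw [hA, mem_filter, mem_neighborChoices] at hf
    exact hf
  have hiter : ∀ f ∈ A, ∀ w, ∀ i ≤ l - 1,
      (Function.update f (f^[l - 1] v) w)^[i] v = f^[i] v := by
    intro f hf w i
    induction i with
    | zero => intro _; rfl
    | succ i ih =>
      intro hi
      rw [Function.iterate_succ_apply', Function.iterate_succ_apply', ih (by omega),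
        Function.update_of_ne]
      intro h
      have hp := (hmem hf).2
      rw [Function.iterate_eq_iterate_iff_of_lt_minimalPeriod (by omega) (by omega)] at h
      omega
  have hclose : ∀ f ∈ A, f (f^[l - 1] v) = v := by
    intro f hf
    rw [← Function.iterate_succ_apply' f, Nat.succ_eq_add_one, Nat.sub_add_cancel hl,
      ← (hmem hf).2]
    exact Function.iterate_minimalPeriod
  calc A.card * δ ≤ ∑ f ∈ A, (G.neighborFinset (f^[l - 1] v)).card := by
        rw [← smul_eq_mul]
        exact card_nsmul_le_sum _ _ _ fun f _ => by
          rw [G.card_neighborFinset_eq_degree]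
          exact hδ _
    _ = (A.sigma fun f => G.neighborFinset (f^[l - 1] v)).card := (card_sigma _ _).symm
    _ ≤ (neighborChoices G).card := by
        refine card_le_card_of_injOn
          (fun p => Function.update p.1 (p.1^[l - 1] v) p.2) ?_ ?_
        · rintro ⟨f, w⟩ h
          obtain ⟨hf, hw⟩ := mem_sigma.1 (mem_coe.1 h)
          refine mem_coe.2 (mem_neighborChoices.2 fun x => ?_)
          rcases eq_or_ne x (f^[l - 1] v) with rfl | hx
          · simpa using hw
          · simpa [hx] using (hmem hf).1 x
        · rintro ⟨f, w⟩ h ⟨g, z⟩ h' heq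
          have hf := (mem_sigma.1 (mem_coe.1 h)).1
          have hg := (mem_sigma.1 (mem_coe.1 h')).1
          simp only at hf hg heq
          have hu : f^[l - 1] v = g^[l - 1] v := by
            rw [← hiter f hf w _ le_rfl, heq, hiter g hg z _ le_rfl]
          have hwz : w = z := by
            have := congrFun heq (f^[l - 1] v)
            rw [Function.update_self, hu, Function.update_self] at this
            exact this
          have hfg : f = g := by
            funext x
            rcases eq_or_ne x (f^[l - 1] v) with rfl | hx
            · rw [hclose f hf, hu, hclose g hg]
            · have := congrFun heq x
              rwa [Function.update_of_ne hx, Function.update_of_ne (hu ▸ hx)] at this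
          rw [hfg, hwz]

lemma sum_componentCount_le {G : SimpleGraph V} {δ : ℕ} (hδ : ∀ v, δ ≤ G.degree v)
    (hpos : 1 ≤ δ) :
    ∑ f ∈ neighborChoices G, (componentCount f : ℝ) ≤
      (neighborChoices G).card * ((Fintype.card V : ℝ) / δ * (1 + Real.log (Fintype.card V))) := by
  have hδ0 : (0 : ℝ) < δ := by exact_mod_cast hpos
  have hharm : ∑ l ∈ Icc 1 (Fintype.card V), (1 : ℝ) / l ≤ 1 + Real.log (Fintype.card V) := by
    have h := harmonic_le_one_add_log (Fintype.card V)
    rw [harmonic_eq_sum_Icc] at h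
    simpa using h
  have hsplit : ∀ (f : V → V) (v : V), (1 : ℝ) / Function.minimalPeriod f v =
      ∑ l ∈ Icc 1 (Fintype.card V), if Function.minimalPeriod f v = l then (1 : ℝ) / l else 0 := by
    intro f v
    rw [sum_ite_eq]
    split_ifs with h
    · rfl
    · have hle : Function.minimalPeriod f v ≤ Fintype.card V := Function.minimalPeriod_le_card
      have : Function.minimalPeriod f v = 0 := by
        rw [mem_Icc] at h
        omega
      simp [this]
  have hvl : ∀ v : V, ∀ l ∈ Icc 1 (Fintype.card V),
      ∑ f ∈ neighborChoices G, (if Function.minimalPeriod f v = l then (1 : ℝ) / l else 0) ≤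
        ((neighborChoices G).card / δ : ℝ) * (1 / l) := by
    intro v l hl
    rw [← sum_filter, sum_const, nsmul_eq_mul]
    gcongr
    rw [le_div_iff₀ hδ0]
    exact_mod_cast card_filter_minimalPeriod_mul_le hδ v (mem_Icc.1 hl).1
  calc ∑ f ∈ neighborChoices G, (componentCount f : ℝ)
      ≤ ∑ f ∈ neighborChoices G, ∑ v, ∑ l ∈ Icc 1 (Fintype.card V),
          (if Function.minimalPeriod f v = l then (1 : ℝ) / l else 0) := by
        refine sum_le_sum fun f _ => (componentCount_le_sum f).trans_eq ?_
        exact sum_congr rfl fun v _ => hsplit f v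
    _ = ∑ v, ∑ l ∈ Icc 1 (Fintype.card V), ∑ f ∈ neighborChoices G,
          (if Function.minimalPeriod f v = l then (1 : ℝ) / l else 0) := by
        rw [sum_comm]
        exact sum_congr rfl fun v _ => sum_comm
    _ ≤ ∑ _v : V, ∑ l ∈ Icc 1 (Fintype.card V), ((neighborChoices G).card / δ : ℝ) * (1 / l) :=
        sum_le_sum fun v _ => sum_le_sum (hvl v)
    _ = Fintype.card V * (((neighborChoices G).card / δ : ℝ) *
          ∑ l ∈ Icc 1 (Fintype.card V), (1 : ℝ) / l) := by
        rw [sum_const, ← mul_sum, nsmul_eq_mul, card_univ]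
    _ ≤ Fintype.card V * (((neighborChoices G).card / δ : ℝ) *
          (1 + Real.log (Fintype.card V))) := by gcongr
    _ = _ := by ring

lemma exp_neg_two_mul_le_one_sub {x : ℝ} (h0 : 0 ≤ x) (h : x ≤ 1 / 2) :
    Real.exp (-(2 * x)) ≤ 1 - x := by
  have h1 := Real.add_one_le_exp (2 * x)
  rw [Real.exp_neg, inv_le_iff_one_le_mul₀ (Real.exp_pos _)]
  nlinarith

/-- A non-trivial minimum cut is respected by a random neighbour choice with probability bounded
below by a constant. -/
lemma exp_mul_card_neighborChoices_le {G : SimpleGraph V} {δ : ℕ} (hδ : ∀ v, δ ≤ G.degree v)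
    (hpos : 1 ≤ δ) (hlam : econn G ≤ δ) {S : Finset V} (hS : 2 ≤ S.card) (hS' : 2 ≤ Sᶜ.card)
    (hmin : (cutPairs G S).card = econn G) :
    Real.exp (-4) * (neighborChoices G).card ≤
      ((neighborChoices G).filter fun f => ∀ v, f v ∈ S ↔ v ∈ S).card := by
  have hδ0 : (0 : ℝ) < δ := by exact_mod_cast hpos
  have hfilter : ((neighborChoices G).filter fun f => ∀ v, f v ∈ S ↔ v ∈ S) =
      Fintype.piFinset fun v => sameNbrs G S v := by
    ext f
    simp only [mem_filter, mem_neighborChoices, Fintype.mem_piFinset, sameNbrs,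
      SimpleGraph.mem_neighborFinset, forall_and]
  have hpt : ∀ v, (G.degree v : ℝ) * Real.exp (-(2 * (crossNbrs G S v).card / δ)) ≤
      (sameNbrs G S v).card := by
    intro v
    have hdeg : (0 : ℝ) < G.degree v := by exact_mod_cast hpos.trans (hδ v)
    have hdδ : (δ : ℝ) ≤ G.degree v := by exact_mod_cast hδ v
    have hadd : ((sameNbrs G S v).card : ℝ) + (crossNbrs G S v).card = G.degree v := by
      exact_mod_cast card_sameNbrs_add_card_crossNbrs G S v
    have hle : ((crossNbrs G S v).card : ℝ) ≤ (sameNbrs G S v).card := by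
      exact_mod_cast card_crossNbrs_le_card_sameNbrs hS hS' hmin v
    have hx : ((crossNbrs G S v).card : ℝ) / G.degree v ≤ 1 / 2 := by
      rw [div_le_iff₀ hdeg]
      linarith
    calc (G.degree v : ℝ) * Real.exp (-(2 * (crossNbrs G S v).card / δ))
        ≤ G.degree v * Real.exp (-(2 * ((crossNbrs G S v).card / G.degree v))) := by
          rw [← mul_div_assoc]
          gcongr
      _ ≤ G.degree v * (1 - (crossNbrs G S v).card / G.degree v) := by
          gcongr
          exact exp_neg_two_mul_le_one_sub (by positivity) hx
      _ = (sameNbrs G S v).card := by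
          field_simp
          linarith
  have hsum : ∑ v, (2 * (crossNbrs G S v).card / δ : ℝ) ≤ 4 := by
    rw [← sum_div, ← mul_sum, div_le_iff₀ hδ0]
    have h1 : (∑ v, ((crossNbrs G S v).card : ℝ)) = 2 * econn G := by
      exact_mod_cast hmin ▸ sum_card_crossNbrs G S
    have h2 : (econn G : ℝ) ≤ δ := by exact_mod_cast hlam
    rw [h1]
    linarith
  rw [hfilter, Fintype.card_piFinset, card_neighborChoices]
  push_cast
  calc Real.exp (-4) * ∏ v, (G.degree v : ℝ)
      ≤ Real.exp (∑ v, -(2 * (crossNbrs G S v).card / δ : ℝ)) * ∏ v, (G.degree v : ℝ) := by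
        gcongr
        rw [sum_neg_distrib]
        linarith
    _ = ∏ v, (G.degree v : ℝ) * Real.exp (-(2 * (crossNbrs G S v).card / δ)) := by
        rw [Real.exp_sum, mul_comm, prod_mul_distrib]
    _ ≤ _ := prod_le_prod (fun v _ => by positivity) fun v _ => hpt v

/-- The non-trivial minimum cuts, each represented by both of its sides. -/
def nontrivialMinCuts (G : SimpleGraph V) : Finset (Finset V) :=
  univ.filter fun S => 2 ≤ S.card ∧ 2 ≤ Sᶜ.card ∧ (bdry G S).card = econn G

lemma card_nontrivialMinCuts_le {G : SimpleGraph V} (hG : G.Connected) {δ : ℕ}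
    (hδ : ∀ v, δ ≤ G.degree v) (hpos : 1 ≤ δ) (hlam : econn G ≤ δ) (hV : 2 ≤ Fintype.card V) :
    ((nontrivialMinCuts G).card : ℝ) ≤ 16 * Real.exp 12 *
      ((Fintype.card V : ℝ) / δ * (1 + Real.log (Fintype.card V))) ^ 2 := by
  have hne : Nonempty V := Fintype.card_pos_iff.1 (by omega)
  have hlam0 : 0 < econn G := by
    refine econn_pos hG (singleton_nonempty hne.some) fun h => ?_
    have := congrArg card h
    rw [card_singleton, card_univ] at this
    omega
  set μ := (Fintype.card V : ℝ) / δ * (1 + Real.log (Fintype.card V)) with hμ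
  have hμ0 : 0 < μ := by
    have h1 : (0 : ℝ) < δ := by exact_mod_cast hpos
    have h2 : (0 : ℝ) < Fintype.card V := by exact_mod_cast (by omega : 0 < Fintype.card V)
    have h3 : 0 ≤ Real.log (Fintype.card V) := Real.log_natCast_nonneg _
    positivity
  set Ω := neighborChoices G with hΩ
  have hΩ0 : (0 : ℝ) < Ω.card := by
    rw [hΩ, card_neighborChoices]
    exact_mod_cast prod_pos fun v _ => hpos.trans (hδ v)
  set K := 2 * Real.exp 4 * μ with hK
  have hK0 : 0 < K := by positivity
  have hexp : Real.exp (-4) * Real.exp 4 = 1 := by rw [← Real.exp_add]; simp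
  -- Markov's inequality for the number of components
  have hmarkov : ((Ω.filter fun f => ¬(componentCount f : ℝ) ≤ K).card : ℝ) ≤
      Real.exp (-4) / 2 * Ω.card := by
    have h1 : ((Ω.filter fun f => ¬(componentCount f : ℝ) ≤ K).card : ℝ) * K ≤ Ω.card * μ := by
      refine le_trans ?_ (sum_componentCount_le hδ hpos)
      rw [← nsmul_eq_mul]
      refine (card_nsmul_le_sum _ _ _ fun f hf => ?_).trans
        (sum_le_sum_of_subset_of_nonneg (filter_subset _ _) fun _ _ _ => by positivity)
      exact (not_le.1 (mem_filter.1 hf).2).le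
    refine le_of_mul_le_mul_right (h1.trans_eq ?_) hK0
    rw [hK]
    linear_combination (-(Ω.card : ℝ) * μ) * hexp
  set Ω' := Ω.filter fun f => (componentCount f : ℝ) ≤ K with hΩ'
  have hlow : ∀ S ∈ nontrivialMinCuts G, Real.exp (-4) / 2 * Ω.card ≤
      ((Ω'.filter fun f => ∀ v, f v ∈ S ↔ v ∈ S).card : ℝ) := by
    intro S hS
    simp only [nontrivialMinCuts, mem_filter, mem_univ, true_and, card_bdry_eq_card_cutPairs] at hS
    have h1 := exp_mul_card_neighborChoices_le hδ hpos hlam hS.1 hS.2.1 hS.2.2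
    have h2 : (Ω.filter fun f => ∀ v, f v ∈ S ↔ v ∈ S) ⊆
        (Ω'.filter fun f => ∀ v, f v ∈ S ↔ v ∈ S) ∪
          Ω.filter fun f => ¬(componentCount f : ℝ) ≤ K := by
      intro f hf
      simp only [hΩ', mem_union, mem_filter] at hf ⊢
      tauto
    have h3 : ((Ω.filter fun f => ∀ v, f v ∈ S ↔ v ∈ S).card : ℝ) ≤
        (Ω'.filter fun f => ∀ v, f v ∈ S ↔ v ∈ S).card +
          (Ω.filter fun f => ¬(componentCount f : ℝ) ≤ K).card := by
      exact_mod_cast (card_le_card h2).trans (card_union_le _ _)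
    linarith
  have hup : ∀ f ∈ Ω', (((nontrivialMinCuts G).filter fun S => ∀ v, f v ∈ S ↔ v ∈ S).card : ℝ) ≤
      2 * K ^ 2 := by
    intro f hf
    have h1 : ((nontrivialMinCuts G).filter fun S => ∀ v, f v ∈ S ↔ v ∈ S) ⊆
        saturatedCuts G (econn G) (componentMk f) := by
      intro S hS
      obtain ⟨hS, hfS⟩ := mem_filter.1 hS
      simp only [nontrivialMinCuts, mem_filter, mem_univ, true_and,
        card_bdry_eq_card_cutPairs] at hS
      exact mem_saturatedCuts.2 ⟨hS.2.2, fun u v huv => mem_iff_of_componentMk_eq hfS huv⟩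
    have h2 := (card_le_card h1).trans (card_saturatedCuts_le G hlam0
      (fun S h h' => econn_le_card_cutPairs G h h') (componentMk f))
    have h3 : (((nontrivialMinCuts G).filter fun S => ∀ v, f v ∈ S ↔ v ∈ S).card : ℝ) ≤
        2 * (componentCount f : ℝ) ^ 2 := by
      rw [componentCount]
      exact_mod_cast h2
    have h4 := (mem_filter.1 hf).2
    refine h3.trans ?_
    gcongr
  have hcount : ((nontrivialMinCuts G).card : ℝ) * (Real.exp (-4) / 2 * Ω.card) ≤
      Ω.card * (2 * K ^ 2) :=
    calc ((nontrivialMinCuts G).card : ℝ) * (Real.exp (-4) / 2 * Ω.card)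
        ≤ ∑ S ∈ nontrivialMinCuts G, ((Ω'.filter fun f => ∀ v, f v ∈ S ↔ v ∈ S).card : ℝ) := by
          rw [← nsmul_eq_mul]
          exact card_nsmul_le_sum _ _ _ hlow
      _ = ∑ f ∈ Ω',
            (((nontrivialMinCuts G).filter fun S => ∀ v, f v ∈ S ↔ v ∈ S).card : ℝ) := by
          exact_mod_cast sum_card_bipartiteAbove_eq_sum_card_bipartiteBelow
            fun (S : Finset V) (f : V → V) => ∀ v, f v ∈ S ↔ v ∈ S
      _ ≤ Ω'.card * (2 * K ^ 2) := by
          rw [← nsmul_eq_mul]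
          exact sum_le_card_nsmul _ _ _ hup
      _ ≤ Ω.card * (2 * K ^ 2) := by
          gcongr
          exact filter_subset _ _
  have hq : 0 < Real.exp (-4) / 2 * Ω.card := by positivity
  refine le_of_mul_le_mul_right (hcount.trans_eq ?_) hq
  have h12 : Real.exp 12 = Real.exp 4 ^ 3 := by
    rw [← Real.exp_nat_mul]
    norm_num
  rw [hK, h12]
  linear_combination (-8 * (Ω.card : ℝ) * μ ^ 2 * Real.exp 4 ^ 2) * hexp

theorem stmt2 :
    ∃ C c : ℝ, 0 < C ∧ 1 ≤ c ∧
      ∀ (V : Type) [Fintype V], ∀ (G : SimpleGraph V) (n δ : ℕ),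
        G.Connected →
        n = Fintype.card V →
        δ = G.minDegree →
        1 ≤ δ →
        (((Finset.univ.filter fun S : Finset V =>
              2 ≤ S.card ∧ 2 ≤ Sᶜ.card ∧ (bdry G S).card = econn G).image
            fun S => ({S, Sᶜ} : Finset (Finset V))).card : ℝ) ≤
          C * ((n : ℝ) / (δ : ℝ)) ^ 2 * Real.log ((n : ℝ) + 2) ^ c := by
  refine ⟨64 * Real.exp 12, 2, by positivity, by norm_num, ?_⟩
  rintro V _ G n δ hG rfl hδ hpos
  have hne : Nonempty V := hG.nonempty
  have hdeg : ∀ v, δ ≤ G.degree v := fun v => hδ ▸ G.minDegree_le_degree v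
  obtain ⟨v₀, hv₀⟩ := G.exists_minimal_degree_vertex
  have hV : 2 ≤ Fintype.card V := by
    have h1 := G.degree_lt_card_verts v₀
    have h2 := hdeg v₀
    omega
  have hlam : econn G ≤ δ := by
    rw [hδ, hv₀]
    exact econn_le_degree G v₀ hV
  have hcard : (((univ.filter fun S : Finset V =>
      2 ≤ S.card ∧ 2 ≤ Sᶜ.card ∧ (bdry G S).card = econn G).image
        fun S => ({S, Sᶜ} : Finset (Finset V))).card : ℝ) ≤ (nontrivialMinCuts G).card := by
    exact_mod_cast card_image_le
  refine (hcard.trans (card_nontrivialMinCuts_le hG hdeg hpos hlam hV)).trans ?_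
  have hn : (2 : ℝ) ≤ Fintype.card V := by exact_mod_cast hV
  have hlog1 : 1 ≤ Real.log ((Fintype.card V : ℝ) + 2) := by
    rw [Real.le_log_iff_exp_le (by linarith)]
    linarith [Real.exp_one_lt_d9]
  have hlog2 : Real.log (Fintype.card V) ≤ Real.log ((Fintype.card V : ℝ) + 2) :=
    Real.log_le_log (by linarith) (by linarith)
  have hlog0 : 0 ≤ Real.log (Fintype.card V) := Real.log_natCast_nonneg _
  rw [Real.rpow_two]
  calc 16 * Real.exp 12 *
        ((Fintype.card V : ℝ) / δ * (1 + Real.log (Fintype.card V))) ^ 2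
      ≤ 16 * Real.exp 12 *
        ((Fintype.card V : ℝ) / δ * (2 * Real.log ((Fintype.card V : ℝ) + 2))) ^ 2 := by
        gcongr
        linarith
    _ = _ := by ring

end
end
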